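/- A locally integrable function b on ℝⁿ×ℝᵐ belongs to bmo_F(ℝⁿ×ℝᵐ) if and only if b ∈ BMO(ℝ^{n+m}) and, for a.e. x ∈ ℝⁿ, b(x,·) ∈ BMO(ℝᵐ) with uniformly bounded norm; moreover the norms are comparable: there exist constants c, C > 0 depending only on n, m such that c · max(‖b‖_{BMO(ℝ^{n+m})}, ess sup_{x∈ℝⁿ} ‖b(x,·)‖_{BMO(ℝᵐ)}) ≤ ‖b‖_{bmo_F} ≤ C · max(‖b‖_{BMO(ℝ^{n+m})}, ess sup_{x∈ℝⁿ} ‖b(x,·)‖_{BMO(ℝᵐ)}). -/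

import Mathlib

open MeasureTheory Filter Topology Set

noncomputable section

namespace FlagPaper

/-- Euclidean norm squared on `Fin d → ℝ`. -/
def eSq {d : ℕ} (x : Fin d → ℝ) : ℝ := ∑ i, x i ^ 2

/-- Euclidean norm on `Fin d → ℝ`. -/
def eN {d : ℕ} (x : Fin d → ℝ) : ℝ := Real.sqrt (eSq x)

/-- The point space ℝⁿ × ℝᵐ. -/
abbrev Spc (n m : ℕ) := (Fin n → ℝ) × (Fin m → ℝ)

/-- Euclidean norm of a point of ℝⁿ × ℝᵐ viewed in ℝ^{n+m}. -/
def eNP {n m : ℕ} (u : Spc n m) : ℝ := Real.sqrt (eSq u.1 + eSq u.2)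

/-- Normalizing constant for the Poisson kernel on ℝ^d, chosen so the kernel has integral 1. -/
def pC (d : ℕ) : ℝ := (∫ x : Fin d → ℝ, (1 + eSq x) ^ (-((d : ℝ) + 1) / 2))⁻¹

/-- Poisson kernel on ℝ^d. -/
def pK (d : ℕ) (x : Fin d → ℝ) : ℝ := pC d * (1 + eSq x) ^ (-((d : ℝ) + 1) / 2)

/-- Dilated Poisson kernel `P_t` on ℝ^d. -/
def pKt (d : ℕ) (t : ℝ) (x : Fin d → ℝ) : ℝ := t ^ (-(d : ℝ)) * pK d (fun i => x i / t)

/-- Normalizing constant for the Poisson kernel of ℝ^{n+m}, realized on ℝⁿ × ℝᵐ. -/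
def pC1 (n m : ℕ) : ℝ := (∫ u : Spc n m, (1 + eSq u.1 + eSq u.2) ^ (-((n : ℝ) + m + 1) / 2))⁻¹

/-- Poisson kernel `P^{(1)}` of ℝ^{n+m}, realized on ℝⁿ × ℝᵐ. -/
def pK1 (n m : ℕ) (u : Spc n m) : ℝ := pC1 n m * (1 + eSq u.1 + eSq u.2) ^ (-((n : ℝ) + m + 1) / 2)

/-- Dilated kernel `P^{(1)}_{t}`. -/
def pK1t (n m : ℕ) (t : ℝ) (u : Spc n m) : ℝ :=
  t ^ (-((n : ℝ) + m)) * pK1 n m (fun i => u.1 i / t, fun j => u.2 j / t)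

/-- The flag Poisson kernel `P_{t₁,t₂} = P^{(1)}_{t₁} *_{ℝᵐ} P^{(2)}_{t₂}`. -/
def flagP (n m : ℕ) (t₁ t₂ : ℝ) (u : Spc n m) : ℝ :=
  ∫ z : Fin m → ℝ, pK1t n m t₁ (u.1, u.2 - z) * pKt m t₂ z

/-- The flag upper half-space parameter domain: points `(x₁, x₂, t₁, t₂)`. -/
abbrev Dom (n m : ℕ) := (Fin n → ℝ) × (Fin m → ℝ) × ℝ × ℝ

def t1 {n m : ℕ} (q : Dom n m) : ℝ := q.2.2.1
def t2 {n m : ℕ} (q : Dom n m) : ℝ := q.2.2.2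

/-- The region `ℝ^{n+1}_+ × ℝ^{m+1}_+`, i.e. `t₁ > 0`, `t₂ > 0`. -/
def domPos (n m : ℕ) : Set (Dom n m) := {q | 0 < t1 q ∧ 0 < t2 q}

/-- Flag Poisson extension of a function on ℝⁿ × ℝᵐ. -/
def flagExt {n m : ℕ} (f : Spc n m → ℝ) (q : Dom n m) : ℝ :=
  ∫ y : Spc n m, flagP n m (t1 q) (t2 q) (q.1 - y.1, q.2.1 - y.2) * f y

/-- Directional (partial) derivative in direction `v`. -/
def pd {n m : ℕ} (v : Dom n m) (U : Dom n m → ℝ) (q : Dom n m) : ℝ := fderiv ℝ U q v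

def e1 {n m : ℕ} (i : Fin n) : Dom n m := (Pi.single i 1, 0, 0, 0)
def e2 {n m : ℕ} (j : Fin m) : Dom n m := (0, Pi.single j 1, 0, 0)
def et1 (n m : ℕ) : Dom n m := (0, 0, 1, 0)
def et2 (n m : ℕ) : Dom n m := (0, 0, 0, 1)

/-- Directions of the gradient `∇^{(1)} = (∂_{t₁}, ∇_{x₁}, ∇_{x₂})` on ℝ^{n+m+1}. -/
def dirs1 (n m : ℕ) : List (Dom n m) :=
  et1 n m :: (List.ofFn (fun i : Fin n => e1 (m := m) i) ++ List.ofFn (fun j : Fin m => e2 (n := n) j))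

/-- Directions of the gradient `∇^{(2)} = (∂_{t₂}, ∇_{x₂})` on ℝ^{m+1}. -/
def dirs2 (n m : ℕ) : List (Dom n m) :=
  et2 n m :: List.ofFn (fun j : Fin m => e2 (n := n) j)

/-- Directions of the spatial gradient `∇_{x₁,x₂}`. -/
def dirsX (n m : ℕ) : List (Dom n m) :=
  List.ofFn (fun i : Fin n => e1 (m := m) i) ++ List.ofFn (fun j : Fin m => e2 (n := n) j)

/-- Directions of the gradient `∇_{x₂}`. -/
def dirsY (n m : ℕ) : List (Dom n m) :=
  List.ofFn (fun j : Fin m => e2 (n := n) j)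

/-- Squared magnitude of the array of mixed second derivatives w.r.t. two families of
directions. -/
def g2 {n m : ℕ} (L1 L2 : List (Dom n m)) (U : Dom n m → ℝ) (q : Dom n m) : ℝ :=
  (L1.map (fun a => (L2.map (fun b => (pd a (pd b U) q) ^ 2)).sum)).sum

/-- Squared magnitude of the array of mixed third derivatives. -/
def g3 {n m : ℕ} (L1 L2 L3 : List (Dom n m)) (U : Dom n m → ℝ) (q : Dom n m) : ℝ :=
  (L1.map (fun a => (L2.map (fun b => (L3.map (fun c =>
    (pd a (pd b (pd c U)) q) ^ 2)).sum)).sum)).sum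

/-- Squared magnitude of the array of mixed fourth derivatives. -/
def g4 {n m : ℕ} (L1 L2 L3 L4 : List (Dom n m)) (U : Dom n m → ℝ) (q : Dom n m) : ℝ :=
  (L1.map (fun a => (L2.map (fun b => (L3.map (fun c => (L4.map (fun d =>
    (pd a (pd b (pd c (pd d U))) q) ^ 2)).sum)).sum)).sum)).sum

/-- An axes-parallel cube in ℝ^d with corner `a` and side length `ℓ`. -/
def cube {d : ℕ} (a : Fin d → ℝ) (ℓ : ℝ) : Set (Fin d → ℝ) :=
  {x | ∀ i, a i ≤ x i ∧ x i ≤ a i + ℓ}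

/-- A flag rectangle `I × J`. -/
def flagRect {n m : ℕ} (a : Fin n → ℝ) (ℓI : ℝ) (c : Fin m → ℝ) (ℓJ : ℝ) : Set (Spc n m) :=
  cube a ℓI ×ˢ cube c ℓJ

/-- Average of `f` over a set. -/
def avgOn {α : Type*} [MeasureSpace α] (S : Set α) (f : α → ℝ) : ℝ :=
  (volume S).toReal⁻¹ * ∫ x in S, f x

/-- Mean oscillation of `f` over a set. -/
def oscOn {α : Type*} [MeasureSpace α] (S : Set α) (f : α → ℝ) : ℝ :=
  avgOn S (fun x => |f x - avgOn S f|)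

/-- Set of mean oscillations over flag rectangles (the little flag bmo data). -/
def bmoFSet (n m : ℕ) (b : Spc n m → ℝ) : Set ℝ :=
  {v | ∃ a ℓI c ℓJ, 0 < ℓI ∧ ℓI ≤ ℓJ ∧ v = oscOn (flagRect a ℓI c ℓJ) b}

/-- The little flag bmo norm `‖b‖_{bmo_F}`. -/
def bmoFNorm (n m : ℕ) (b : Spc n m → ℝ) : ℝ := sSup (bmoFSet n m b)

/-- Set of mean oscillations over cubes in ℝ^d (John–Nirenberg BMO data). -/
def bmoSet (d : ℕ) (g : (Fin d → ℝ) → ℝ) : Set ℝ :=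
  {v | ∃ a ℓ, 0 < ℓ ∧ v = oscOn (cube a ℓ) g}

/-- The John–Nirenberg BMO(ℝ^d) norm. -/
def bmoNorm (d : ℕ) (g : (Fin d → ℝ) → ℝ) : ℝ := sSup (bmoSet d g)

/-- BMO(ℝ^{n+m}) data for a function on the product model ℝⁿ × ℝᵐ:
cubes of ℝ^{n+m} are exactly products `I × J` with `ℓ(I) = ℓ(J)`. -/
def bmoProdSet (n m : ℕ) (b : Spc n m → ℝ) : Set ℝ :=
  {v | ∃ a c ℓ, 0 < ℓ ∧ v = oscOn (flagRect a ℓ c ℓ) b}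

/-- The BMO(ℝ^{n+m}) norm on the product model. -/
def bmoProdNorm (n m : ℕ) (b : Spc n m → ℝ) : ℝ := sSup (bmoProdSet n m b)

/-- The set of `A_{F,p}` products of averages over flag rectangles. -/
def apSet (n m : ℕ) (p : ℝ) (w : Spc n m → ℝ) : Set ℝ :=
  {v | ∃ a ℓI c ℓJ, 0 < ℓI ∧ ℓI ≤ ℓJ ∧
    v = avgOn (flagRect a ℓI c ℓJ) w *
      (avgOn (flagRect a ℓI c ℓJ) (fun x => w x ^ (1 - p / (p - 1)))) ^ (p - 1)}

/-- The flag Muckenhoupt characteristic `[w]_{A_{F,p}}`. -/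
def apChar (n m : ℕ) (p : ℝ) (w : Spc n m → ℝ) : ℝ := sSup (apSet n m p w)

/-- The Carleson box `T(R)` over the flag rectangle determined by `a, ℓI, c, ℓJ`. -/
def TBox {n m : ℕ} (a : Fin n → ℝ) (ℓI : ℝ) (c : Fin m → ℝ) (ℓJ : ℝ) : Set (Dom n m) :=
  {q | q.1 ∈ cube a ℓI ∧ (ℓI / 2 < t1 q ∧ t1 q ≤ ℓI) ∧
       q.2.1 ∈ cube c ℓJ ∧ (ℓJ / 2 < t2 q ∧ t2 q ≤ ℓJ)}

/-- `T(Ω) = ⋃_{R ⊂ Ω} T(R)`, the union over flag rectangles contained in `Ω`. -/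
def TOmega {n m : ℕ} (Ω : Set (Spc n m)) : Set (Dom n m) :=
  ⋃ (a : Fin n → ℝ) (ℓI : ℝ) (c : Fin m → ℝ) (ℓJ : ℝ)
    (_ : 0 < ℓI ∧ ℓI ≤ ℓJ ∧ flagRect a ℓI c ℓJ ⊆ Ω), TBox a ℓI c ℓJ

/-- Set of flag Carleson quantities defining the flag BMO norm of `b`. -/
def flagBMOSet (n m : ℕ) (b : Spc n m → ℝ) : Set ℝ :=
  {v | ∃ Ω : Set (Spc n m), IsOpen Ω ∧ 0 < volume Ω ∧ volume Ω ≠ ⊤ ∧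
    v = Real.sqrt ((volume Ω).toReal⁻¹ *
      ∫ q in TOmega Ω, (t1 q) ^ 2 * (t2 q) ^ 2 *
        g2 (dirs1 n m) (dirs2 n m) (flagExt b) q / (t1 q * t2 q))}

/-- The flag BMO norm `‖b‖_{BMO_F}`. -/
def flagBMONorm (n m : ℕ) (b : Spc n m → ℝ) : ℝ := sSup (flagBMOSet n m b)

/-- Dilated indicator `χ^{(1)}_{t}` of the unit ball of ℝ^{n+m}. -/
def chi1t (n m : ℕ) (t : ℝ) (u : Spc n m) : ℝ :=
  t ^ (-((n : ℝ) + m)) *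
    (if eSq (fun i => u.1 i / t) + eSq (fun j => u.2 j / t) ≤ 1 then (1 : ℝ) else 0)

/-- Dilated indicator `χ^{(2)}_{t}` of the unit ball of ℝᵐ. -/
def chi2t (m : ℕ) (t : ℝ) (z : Fin m → ℝ) : ℝ :=
  t ^ (-(m : ℝ)) * (if eSq (fun j => z j / t) ≤ 1 then (1 : ℝ) else 0)

/-- `χ_{t₁,t₂} = χ^{(1)}_{t₁} *_{ℝᵐ} χ^{(2)}_{t₂}`. -/
def chiF (n m : ℕ) (t₁ t₂ : ℝ) (u : Spc n m) : ℝ :=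
  ∫ z : Fin m → ℝ, chi1t n m t₁ (u.1, u.2 - z) * chi2t m t₂ z

/-- The general flag Lusin area integral `S_{F,L}(G)`. -/
def SFL (n m : ℕ) (G : Dom n m → ℝ) (x : Spc n m) : ℝ :=
  Real.sqrt (∫ q in domPos n m,
    chiF n m (t1 q) (t2 q) (x.1 - q.1, x.2 - q.2.1) * (G q) ^ 2 /
      ((t1 q) ^ (n + m + 1) * (t2 q) ^ (m + 1)))

/-- The flag Lusin area integral `S_F(u)` of the flag Poisson extension of `f`. -/
def SFlag (n m : ℕ) (f : Spc n m → ℝ) (x : Spc n m) : ℝ :=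
  Real.sqrt (∫ q in domPos n m,
    chiF n m (t1 q) (t2 q) (x.1 - q.1, x.2 - q.2.1) *
      ((t1 q) ^ 2 * (t2 q) ^ 2 * g2 (dirs1 n m) (dirs2 n m) (flagExt f) q) /
      ((t1 q) ^ (n + m + 1) * (t2 q) ^ (m + 1)))

/-- The constant `c_d` of the Riesz transforms on ℝ^d. -/
def rieszC (d : ℕ) : ℝ := Real.Gamma (((d : ℝ) + 1) / 2) / Real.pi ^ (((d : ℝ) + 1) / 2)

/-- The `j`-th Riesz transform `R^{(1)}_j` on ℝ^{n+m} (realized on ℝⁿ × ℝᵐ),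
defined as a principal value. -/
def R1 {n m : ℕ} (j : Fin (n + m)) (g : Spc n m → ℝ) (x : Spc n m) : ℝ :=
  limUnder (𝓝[>] (0 : ℝ)) (fun ε =>
    rieszC (n + m) * ∫ y in {y : Spc n m | ε < eNP (x - y)},
      (Fin.append x.1 x.2 j - Fin.append y.1 y.2 j) / eNP (x - y) ^ (n + m + 1) * g y)

/-- The `k`-th Riesz transform `R^{(2)}_k` on ℝᵐ acting in the second variable,
defined as a principal value. -/
def R2 {n m : ℕ} (k : Fin m) (f : Spc n m → ℝ) (x : Spc n m) : ℝ :=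
  limUnder (𝓝[>] (0 : ℝ)) (fun ε =>
    rieszC m * ∫ z in {z : Fin m → ℝ | ε < eN (x.2 - z)},
      (x.2 k - z k) / eN (x.2 - z) ^ (m + 1) * f (x.1, z))

/-- The iterated commutator `[[b, R^{(1)}_j], R^{(2)}_k]₂ f`. -/
def iterCommR {n m : ℕ} (b : Spc n m → ℝ) (j : Fin (n + m)) (k : Fin m)
    (f : Spc n m → ℝ) : Spc n m → ℝ := fun x =>
  b x * R1 j (R2 k f) x - R1 j (fun u => b u * R2 k f u) x
    - R2 k (fun u => b u * R1 j f u) x + R2 k (R1 j (fun u => b u * f u)) x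

/-- The iterated commutator `[[b, R^{(2)}_k]₂, R^{(1)}_j] f`. -/
def iterCommR' {n m : ℕ} (b : Spc n m → ℝ) (j : Fin (n + m)) (k : Fin m)
    (f : Spc n m → ℝ) : Spc n m → ℝ := fun x =>
  b x * R2 k (R1 j f) x - R2 k (fun u => b u * R1 j f u) x
    - R1 j (fun u => b u * R2 k f u) x + R1 j (R2 k (fun u => b u * f u)) x

/-- The big commutator `[b, R_{j,k}] f` where `R_{j,k} = R^{(1)}_j ∗ R^{(2)}_k ∗₂ ·`. -/
def bigCommR {n m : ℕ} (b : Spc n m → ℝ) (j : Fin (n + m)) (k : Fin m)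
    (f : Spc n m → ℝ) : Spc n m → ℝ := fun x =>
  b x * R1 j (R2 k f) x - R1 j (R2 k (fun u => b u * f u)) x

/-- Explicit `L^p` norm. -/
def lpNorm {α : Type*} [MeasureSpace α] (p : ℝ) (f : α → ℝ) : ℝ :=
  (∫ x, |f x| ^ p) ^ (1 / p)

/-- Dot product on ℝⁿ × ℝᵐ viewed as ℝ^{n+m}. -/
def dotS {n m : ℕ} (u v : Spc n m) : ℝ := (∑ i, u.1 i * v.1 i) + ∑ j, u.2 j * v.2 j

/-- Fourier transform on ℝⁿ × ℝᵐ ≅ ℝ^{n+m}. -/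
def fT {n m : ℕ} (g : Spc n m → ℝ) (ξ : Spc n m) : ℂ :=
  ∫ y : Spc n m, Complex.exp (-(((2 * Real.pi * dotS y ξ : ℝ) : ℂ) * Complex.I)) * (g y : ℂ)

/-- The Fourier multiplier `(−Δ_{x₁,x₂})^{1/2}` with symbol `2π|(ξ₁,ξ₂)|`. -/
def sqlapFull {n m : ℕ} (g : Spc n m → ℝ) (x : Spc n m) : ℝ :=
  (∫ ξ : Spc n m, Complex.exp (((2 * Real.pi * dotS x ξ : ℝ) : ℂ) * Complex.I) *
    ((2 * Real.pi * eNP ξ : ℝ) : ℂ) * fT g ξ).re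

/-- Fourier transform on ℝᵐ. -/
def fT2 {m : ℕ} (g : (Fin m → ℝ) → ℝ) (ξ : Fin m → ℝ) : ℂ :=
  ∫ z : Fin m → ℝ,
    Complex.exp (-(((2 * Real.pi * ∑ j, z j * ξ j : ℝ) : ℂ) * Complex.I)) * (g z : ℂ)

/-- The Fourier multiplier `(−Δ_{x₂})^{1/2}` with symbol `2π|ξ₂|`, acting in the second
variable. -/
def sqlap2 {n m : ℕ} (g : Spc n m → ℝ) (x : Spc n m) : ℝ :=
  (∫ ξ : Fin m → ℝ, Complex.exp (((2 * Real.pi * ∑ j, x.2 j * ξ j : ℝ) : ℂ) * Complex.I) *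
    ((2 * Real.pi * eN ξ : ℝ) : ℂ) * fT2 (fun z => g (x.1, z)) ξ).re

/-- Coordinate direction in ℝⁿ × ℝᵐ ≅ ℝ^{n+m}. -/
def edir (n m : ℕ) (j : Fin (n + m)) : Spc n m :=
  Fin.addCases (motive := fun _ => Spc n m)
    (fun i => (Pi.single i 1, 0)) (fun i => (0, Pi.single i 1)) j

/-- Distributional divergence-free condition for a vector field on ℝⁿ × ℝᵐ ≅ ℝ^{n+m}. -/
def divFree (n m : ℕ) (E : Spc n m → Fin (n + m) → ℝ) : Prop :=
  ∀ φ : Spc n m → ℝ, ContDiff ℝ (⊤ : ℕ∞) φ → HasCompactSupport φ →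
    ∑ j, ∫ u, E u j * fderiv ℝ φ u (edir n m j) = 0

/-- Distributional curl-free condition for a vector field on ℝⁿ × ℝᵐ ≅ ℝ^{n+m}. -/
def curlFree (n m : ℕ) (B : Spc n m → Fin (n + m) → ℝ) : Prop :=
  ∀ φ : Spc n m → ℝ, ContDiff ℝ (⊤ : ℕ∞) φ → HasCompactSupport φ →
    ∀ i j : Fin (n + m),
      ∫ u, B u j * fderiv ℝ φ u (edir n m i) = ∫ u, B u i * fderiv ℝ φ u (edir n m j)

/-- Distributional divergence-free condition for a vector field on ℝᵐ. -/
def divFreeM (m : ℕ) (E : (Fin m → ℝ) → Fin m → ℝ) : Prop :=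
  ∀ φ : (Fin m → ℝ) → ℝ, ContDiff ℝ (⊤ : ℕ∞) φ → HasCompactSupport φ →
    ∑ k, ∫ z, E z k * fderiv ℝ φ z (Pi.single k 1) = 0

/-- Distributional curl-free condition for a vector field on ℝᵐ. -/
def curlFreeM (m : ℕ) (B : (Fin m → ℝ) → Fin m → ℝ) : Prop :=
  ∀ φ : (Fin m → ℝ) → ℝ, ContDiff ℝ (⊤ : ℕ∞) φ → HasCompactSupport φ →
    ∀ k k' : Fin m,
      ∫ z, B z k' * fderiv ℝ φ z (Pi.single k 1) = ∫ z, B z k * fderiv ℝ φ z (Pi.single k' 1)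

/-- The matrix entries `E_{j,k} = E^{(1)}_j ∗₂ E^{(2)}_k`. -/
def pairField (n m : ℕ) (E1 : Spc n m → Fin (n + m) → ℝ) (E2 : (Fin m → ℝ) → Fin m → ℝ)
    (u : Spc n m) (j : Fin (n + m)) (k : Fin m) : ℝ :=
  ∫ z : Fin m → ℝ, E1 (u.1, u.2 - z) j * E2 z k

/-- The dot product `E · B` of two matrix-valued flag fields. -/
def dotField (n m : ℕ) (E1 : Spc n m → Fin (n + m) → ℝ) (E2 : (Fin m → ℝ) → Fin m → ℝ)
    (B1 : Spc n m → Fin (n + m) → ℝ) (B2 : (Fin m → ℝ) → Fin m → ℝ) (u : Spc n m) : ℝ :=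
  ∑ j : Fin (n + m), ∑ k : Fin m, pairField n m E1 E2 u j k * pairField n m B1 B2 u j k

/-- One-parameter directional derivative on (ℝⁿ × ℝᵐ) × ℝ. -/
def pd1 {n m : ℕ} (v : Spc n m × ℝ) (U : Spc n m × ℝ → ℝ) (q : Spc n m × ℝ) : ℝ :=
  fderiv ℝ U q v

/-- Squared magnitude of the full gradient `∇_{x,t}` on ℝ^{n+m+1}. -/
def grad1Sq {n m : ℕ} (U : Spc n m × ℝ → ℝ) (q : Spc n m × ℝ) : ℝ :=
  (pd1 ((0, 0), 1) U q) ^ 2 + (∑ i : Fin n, (pd1 ((Pi.single i 1, 0), 0) U q) ^ 2)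
    + ∑ j : Fin m, (pd1 ((0, Pi.single j 1), 0) U q) ^ 2

/-- One-parameter Poisson extension of a function on ℝⁿ × ℝᵐ ≅ ℝ^{n+m}. -/
def pExt1 {n m : ℕ} (f : Spc n m → ℝ) (q : Spc n m × ℝ) : ℝ :=
  ∫ y : Spc n m, pK1t n m q.2 (q.1.1 - y.1, q.1.2 - y.2) * f y

/-- The classical one-parameter Lusin area integral on ℝ^{n+m} of (the Poisson extension of)
`f`, characterizing the Hardy space `H¹(ℝ^{n+m})`. -/
def SOne (n m : ℕ) (f : Spc n m → ℝ) (x : Spc n m) : ℝ :=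
  Real.sqrt (∫ q in {q : Spc n m × ℝ | 0 < q.2 ∧ eNP (x - q.1) < q.2},
    q.2 ^ 2 * grad1Sq (pExt1 f) q / q.2 ^ (n + m + 1))

/-- Commutator of a function with an operator: `[b,T] f = b ⬝ Tf − T(bf)`. -/
def commOp {α : Type*} (b : α → ℝ) (T : (α → ℝ) → (α → ℝ)) : (α → ℝ) → (α → ℝ) :=
  fun f => b * T f - T (b * f)

/-- Iterated commutator `C^k_{b⃗}(T) = [b_k, [b_{k−1}, ⋯ [b₁, T] ⋯]]`. -/
def iterCommOp {α : Type*} : (k : ℕ) → (Fin k → α → ℝ) → ((α → ℝ) → (α → ℝ)) →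
    ((α → ℝ) → (α → ℝ))
  | 0, _, T => T
  | (k + 1), b, T => commOp (b (Fin.last k)) (iterCommOp k (fun j => b j.castSucc) T)

/-- Weighted measure `w dx`. -/
def wMeasure {α : Type*} [MeasureSpace α] (w : α → ℝ) : Measure α :=
  volume.withDensity (fun x => ENNReal.ofReal (w x))

end FlagPaper

open FlagPaper MeasureTheory

namespace FlagPaper

theorem volume_mul_avgOn {α : Type*} [MeasureSpace α] {S : Set α} (hS : 0 < (volume S).toReal)
    (f : α → ℝ) : (volume S).toReal * avgOn S f = ∫ x in S, f x := by
  rw [avgOn, mul_inv_cancel_left₀ hS.ne']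

theorem volume_mul_oscOn {α : Type*} [MeasureSpace α] {S : Set α} (hS : 0 < (volume S).toReal)
    (f : α → ℝ) : (volume S).toReal * oscOn S f = ∫ x in S, |f x - avgOn S f| :=
  volume_mul_avgOn hS _

theorem oscOn_nonneg {α : Type*} [MeasureSpace α] (S : Set α) (f : α → ℝ) : 0 ≤ oscOn S f :=
  mul_nonneg (inv_nonneg.2 ENNReal.toReal_nonneg) (integral_nonneg fun _ => abs_nonneg _)

theorem integrableOn_abs_sub_const {α : Type*} [MeasureSpace α] {S : Set α} {f : α → ℝ}
    (hS : volume S ≠ ⊤) (hf : IntegrableOn f S) (c : ℝ) :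
    IntegrableOn (fun x => |f x - c|) S :=
  (Integrable.sub hf (integrableOn_const hS)).abs

/-- The mean oscillation is at most twice the mean deviation from any constant. -/
theorem volume_mul_oscOn_le {α : Type*} [MeasureSpace α] {S : Set α} {f : α → ℝ}
    (hS : 0 < (volume S).toReal) (hf : IntegrableOn f S) (c : ℝ) :
    (volume S).toReal * oscOn S f ≤ 2 * ∫ x in S, |f x - c| := by
  have hS' : volume S ≠ ⊤ := (ENNReal.toReal_pos_iff.1 hS).2.ne
  rw [volume_mul_oscOn hS]
  have hmean : (volume S).toReal * |c - avgOn S f| ≤ ∫ x in S, |f x - c| := by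
    have h : (volume S).toReal * (avgOn S f - c) = ∫ x in S, (f x - c) := by
      rw [integral_sub hf (integrableOn_const hS'), mul_sub, volume_mul_avgOn hS]
      simp [Measure.real]
    rw [abs_sub_comm]
    nth_rw 1 [← abs_of_pos hS]
    rw [← abs_mul, h]
    exact abs_integral_le_integral_abs
  calc ∫ x in S, |f x - avgOn S f|
      ≤ ∫ x in S, (|f x - c| + |c - avgOn S f|) :=
        integral_mono (integrableOn_abs_sub_const hS' hf _)
          ((integrableOn_abs_sub_const hS' hf c).add (integrableOn_const hS'))
          fun x => abs_sub_le _ _ _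
    _ = (∫ x in S, |f x - c|) + (volume S).toReal * |c - avgOn S f| := by
        rw [integral_add (integrableOn_abs_sub_const hS' hf c) (integrableOn_const hS')]
        simp [Measure.real]
    _ ≤ _ := by linarith

theorem oscOn_le_of_subset {α : Type*} [MeasureSpace α] {S T : Set α} {f : α → ℝ} {D : ℝ}
    (hST : S ⊆ T) (hS : 0 < (volume S).toReal) (hT : volume T ≠ ⊤) (hf : IntegrableOn f T)
    (hD : (volume T).toReal ≤ D * (volume S).toReal) :
    oscOn S f ≤ 2 * D * oscOn T f := by
  have hT0 : 0 < (volume T).toReal :=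
    hS.trans_le (ENNReal.toReal_mono hT (measure_mono hST))
  refine le_of_mul_le_mul_left ?_ hS
  calc (volume S).toReal * oscOn S f
      ≤ 2 * ∫ x in S, |f x - avgOn T f| := volume_mul_oscOn_le hS (hf.mono_set hST) _
    _ ≤ 2 * ∫ x in T, |f x - avgOn T f| := by
        refine mul_le_mul_of_nonneg_left ?_ zero_le_two
        exact setIntegral_mono_set (integrableOn_abs_sub_const hT hf _)
          (Eventually.of_forall fun _ => abs_nonneg _) hST.eventuallyLE
    _ = 2 * ((volume T).toReal * oscOn T f) := by rw [volume_mul_oscOn hT0]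
    _ ≤ 2 * ((D * (volume S).toReal) * oscOn T f) := by
        gcongr
        exact oscOn_nonneg _ _
    _ = _ := by ring

theorem oscOn_congr_set {α : Type*} [MeasureSpace α] {S T : Set α} (h : S =ᵐ[volume] T)
    (f : α → ℝ) : oscOn S f = oscOn T f := by
  simp only [oscOn, avgOn, measure_congr h, setIntegral_congr_set h]

theorem cube_eq_Icc {d : ℕ} (a : Fin d → ℝ) (ℓ : ℝ) : cube a ℓ = Icc a (fun i => a i + ℓ) := by
  ext x
  simp [cube, Pi.le_def, forall_and]

theorem isCompact_cube {d : ℕ} (a : Fin d → ℝ) (ℓ : ℝ) : IsCompact (cube a ℓ) := by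
  rw [cube_eq_Icc]
  exact isCompact_Icc

theorem volume_cube {d : ℕ} (a : Fin d → ℝ) {ℓ : ℝ} (hℓ : 0 ≤ ℓ) :
    (volume (cube a ℓ)).toReal = ℓ ^ d := by
  rw [cube_eq_Icc, Real.volume_Icc_pi_toReal (fun i => by simpa using hℓ)]
  simp

theorem volume_flagRect {n m : ℕ} (a : Fin n → ℝ) (c : Fin m → ℝ) {r s : ℝ} (hr : 0 ≤ r)
    (hs : 0 ≤ s) : (volume (flagRect a r c s)).toReal = r ^ n * s ^ m := by
  rw [flagRect, Measure.volume_eq_prod, Measure.prod_prod, ENNReal.toReal_mul, volume_cube a hr,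
    volume_cube c hs]

theorem isCompact_flagRect {n m : ℕ} (a : Fin n → ℝ) (c : Fin m → ℝ) (r s : ℝ) :
    IsCompact (flagRect a r c s) :=
  (isCompact_cube a r).prod (isCompact_cube c s)

theorem cube_subset_cube {d : ℕ} {a a' : Fin d → ℝ} {r r' : ℝ} (h : ∀ i, a' i ≤ a i)
    (h' : ∀ i, a i + r ≤ a' i + r') : cube a r ⊆ cube a' r' :=
  fun _ hx i => ⟨(h i).trans (hx i).1, (hx i).2.trans (h' i)⟩

theorem closedBall_eq_cube {d : ℕ} (x : Fin d → ℝ) {r : ℝ} (hr : 0 ≤ r) :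
    Metric.closedBall x r = cube (fun i => x i - r) (2 * r) := by
  ext y
  simp only [Metric.mem_closedBall, dist_pi_le_iff hr, cube, mem_ofPred_eq, Real.dist_eq, abs_le]
  refine forall_congr' fun i => ⟨fun h => ⟨?_, ?_⟩, fun h => ⟨?_, ?_⟩⟩ <;> linarith [h.1, h.2]

section Slices

variable {n m : ℕ} {b : Spc n m → ℝ}

theorem integrableOn_prod_iff {S : Set (Fin n → ℝ)} {T : Set (Fin m → ℝ)} {f : Spc n m → ℝ} :
    IntegrableOn f (S ×ˢ T) ↔
      Integrable f ((volume.restrict S).prod (volume.restrict T)) := by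
  rw [IntegrableOn, Measure.volume_eq_prod, Measure.prod_restrict]

theorem ae_forall_integrableOn_cube (hb : LocallyIntegrable b volume) :
    ∀ᵐ x : Fin n → ℝ, ∀ (c : Fin m → ℝ) (ℓ : ℝ),
      IntegrableOn (fun y => b (x, y)) (cube c ℓ) := by
  have h (N : ℕ) : ∀ᵐ x : Fin n → ℝ, x ∈ Metric.closedBall (0 : Fin n → ℝ) N →
      IntegrableOn (fun y => b (x, y)) (Metric.closedBall (0 : Fin m → ℝ) N) := by
    rw [← ae_restrict_iff' Metric.isClosed_closedBall.measurableSet]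
    refine Integrable.prod_right_ae (integrableOn_prod_iff.1 (hb.integrableOn_isCompact ?_))
    exact (isCompact_closedBall _ _).prod (isCompact_closedBall _ _)
  filter_upwards [ae_all_iff.2 h] with x hx c ℓ
  obtain ⟨R, hR⟩ := (isCompact_cube c ℓ).isBounded.subset_closedBall 0
  obtain ⟨N, hN⟩ := exists_nat_ge (max R ‖x‖)
  exact (hx N (by simpa using (le_max_right _ _).trans hN)).mono_set
    (hR.trans (Metric.closedBall_subset_closedBall ((le_max_left _ _).trans hN)))

theorem integrableOn_oscOn_slice {S : Set (Fin n → ℝ)} {T : Set (Fin m → ℝ)}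
    (hT : volume T ≠ ⊤) (hb : IntegrableOn b (S ×ˢ T)) :
    IntegrableOn (fun x => oscOn T (fun y => b (x, y))) S := by
  have : IsFiniteMeasure (volume.restrict T) := isFiniteMeasure_restrict.2 hT
  have hb' := integrableOn_prod_iff.1 hb
  have havg : Integrable (fun z : Spc n m => avgOn T (fun y => b (z.1, y)))
      ((volume.restrict S).prod (volume.restrict T)) :=
    Integrable.comp_fst (f := fun x => avgOn T (fun y => b (x, y)))
      (hb'.integral_prod_left.const_mul _) _
  exact (hb'.sub havg).abs.integral_prod_left.const_mul _

theorem setIntegral_oscOn_slice_le {S : Set (Fin n → ℝ)} {T : Set (Fin m → ℝ)}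
    (hS : 0 < (volume S).toReal) (hT : 0 < (volume T).toReal)
    (hb : IntegrableOn b (S ×ˢ T)) :
    ∫ x in S, oscOn T (fun y => b (x, y)) ≤ 2 * (volume S).toReal * oscOn (S ×ˢ T) b := by
  have hT' : volume T ≠ ⊤ := (ENNReal.toReal_pos_iff.1 hT).2.ne
  have hv : (volume (S ×ˢ T)).toReal = (volume S).toReal * (volume T).toReal := by
    rw [Measure.volume_eq_prod, Measure.prod_prod, ENNReal.toReal_mul]
  have hST : 0 < (volume (S ×ˢ T)).toReal := hv ▸ mul_pos hS hT
  have hST' : volume (S ×ˢ T) ≠ ⊤ := (ENNReal.toReal_pos_iff.1 hST).2.ne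
  have hb' := integrableOn_prod_iff.1 hb
  have hdev := integrableOn_abs_sub_const hST' hb (avgOn (S ×ˢ T) b)
  refine le_of_mul_le_mul_left ?_ hT
  calc (volume T).toReal * ∫ x in S, oscOn T (fun y => b (x, y))
      = ∫ x in S, (volume T).toReal * oscOn T (fun y => b (x, y)) := by
        rw [integral_const_mul]
    _ ≤ ∫ x in S, 2 * ∫ y in T, |b (x, y) - avgOn (S ×ˢ T) b| := by
        refine integral_mono_ae ((integrableOn_oscOn_slice hT' hb).const_mul _)
          ((integrableOn_prod_iff.1 hdev).integral_prod_left.const_mul _) ?_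
        filter_upwards [hb'.prod_right_ae] with x hx
        exact volume_mul_oscOn_le hT hx _
    _ = 2 * ∫ z in S ×ˢ T, |b z - avgOn (S ×ˢ T) b| := by
        rw [integral_const_mul, Measure.volume_eq_prod,
          setIntegral_prod _ (by rwa [Measure.volume_eq_prod] at hdev)]
    _ = _ := by
        rw [← volume_mul_oscOn hST, hv]
        ring

theorem ae_oscOn_slice_le (hb : LocallyIntegrable b volume) {M : ℝ} (c : Fin m → ℝ) {s : ℝ}
    (hs : 0 < s) (hM : ∀ a r, 0 < r → r ≤ s → oscOn (flagRect a r c s) b ≤ M) :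
    ∀ᵐ x : Fin n → ℝ, oscOn (cube c s) (fun y => b (x, y)) ≤ 2 * M := by
  have hcube {d : ℕ} (a : Fin d → ℝ) {r : ℝ} (hr : 0 < r) : 0 < (volume (cube a r)).toReal := by
    rw [volume_cube a hr.le]
    positivity
  have hbI (a : Fin n → ℝ) (r : ℝ) : IntegrableOn b (cube a r ×ˢ cube c s) :=
    hb.integrableOn_isCompact (isCompact_flagRect a c r s)
  have hG : LocallyIntegrable (fun x : Fin n → ℝ => oscOn (cube c s) (fun y => b (x, y)))
      volume := fun x => ⟨Metric.closedBall x 1, Metric.closedBall_mem_nhds x one_pos, by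
    rw [closedBall_eq_cube x zero_le_one]
    exact integrableOn_oscOn_slice (isCompact_cube c s).measure_ne_top (hbI _ _)⟩
  filter_upwards [IsUnifLocDoublingMeasure.ae_tendsto_average volume hG 1] with x hx
  have hδpos (k : ℕ) : 0 < s / 2 * (1 / ((k : ℝ) + 1)) := by positivity
  have hδ : Tendsto (fun k : ℕ => s / 2 * (1 / ((k : ℝ) + 1))) atTop (𝓝[>] 0) := by
    refine tendsto_nhdsWithin_iff.2 ⟨?_, Eventually.of_forall hδpos⟩
    simpa using tendsto_one_div_add_atTop_nhds_zero_nat.const_mul (s / 2)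
  refine le_of_tendsto' (hx (fun _ => x) _ hδ (Eventually.of_forall fun k => ?_)) fun k => ?_
  · simpa using (hδpos k).le
  · set δ := s / 2 * (1 / ((k : ℝ) + 1)) with hδ_def
    have hk : 0 < δ := hδpos k
    have hk' : 2 * δ ≤ s := by
      have : 1 / ((k : ℝ) + 1) ≤ 1 := by
        rw [div_le_one (by positivity)]
        linarith [k.cast_nonneg (α := ℝ)]
      calc 2 * δ = s * (1 / ((k : ℝ) + 1)) := by rw [hδ_def]; ring
        _ ≤ s * 1 := by gcongr
        _ = s := mul_one s
    have hV := hcube (fun i => x i - δ) (mul_pos two_pos hk)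
    rw [setAverage_eq, smul_eq_mul, closedBall_eq_cube x hk.le, Measure.real, inv_mul_le_iff₀ hV]
    refine (setIntegral_oscOn_slice_le hV (hcube c hs) (hbI _ _)).trans ?_
    have := hM (fun i => x i - δ) (2 * δ) (by positivity) hk'
    rw [flagRect] at this
    nlinarith

theorem exists_rat_cube_superset {d : ℕ} (a : Fin d → ℝ) {r : ℝ} (hr : 0 < r) :
    ∃ (p : Fin d → ℚ) (q : ℚ), 0 < (q : ℝ) ∧ (q : ℝ) ≤ 2 * r ∧
      cube a r ⊆ cube (fun i => (p i : ℝ)) q := by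
  have hp (i : Fin d) : ∃ p : ℚ, a i - r / 4 < p ∧ (p : ℝ) < a i := exists_rat_btwn (by linarith)
  choose p hp using hp
  obtain ⟨q, hq, hq'⟩ := exists_rat_btwn (show 3 / 2 * r < 2 * r by linarith)
  exact ⟨p, q, by linarith, hq'.le, cube_subset_cube (fun i => (hp i).2.le)
    fun i => by linarith [(hp i).1]⟩

theorem ae_forall_oscOn_slice_le (hb : LocallyIntegrable b volume) {M : ℝ}
    (hM : ∀ a r c s, 0 < r → r ≤ s → oscOn (flagRect a r c s) b ≤ M) :
    ∀ᵐ x : Fin n → ℝ, ∀ (c : Fin m → ℝ) (s : ℝ), 0 < s →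
      oscOn (cube c s) (fun y => b (x, y)) ≤ 2 ^ (m + 2) * M := by
  have hrat : ∀ᵐ x : Fin n → ℝ, ∀ (p : Fin m → ℚ) (q : ℚ), 0 < (q : ℝ) →
      oscOn (cube (fun i => (p i : ℝ)) q) (fun y => b (x, y)) ≤ 2 * M := by
    simp only [ae_all_iff]
    exact fun p q hq => ae_oscOn_slice_le hb _ hq fun a r hr hrq => hM a r _ _ hr hrq
  filter_upwards [hrat, ae_forall_integrableOn_cube hb] with x hx hbx c s hs
  obtain ⟨p, q, hq, hqs, hsub⟩ := exists_rat_cube_superset c hs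
  calc oscOn (cube c s) (fun y => b (x, y))
      ≤ 2 * 2 ^ m * oscOn (cube (fun i => (p i : ℝ)) q) (fun y => b (x, y)) := by
        refine oscOn_le_of_subset hsub ?_ (isCompact_cube _ _).measure_ne_top (hbx _ _) ?_
        · rw [volume_cube c hs.le]
          positivity
        · rw [volume_cube _ hq.le, volume_cube c hs.le, ← mul_pow]
          gcongr
    _ ≤ 2 * 2 ^ m * (2 * M) := by
        gcongr
        exact hx p q hq
    _ = _ := by ring

/-- Deviations on the pieces `S ×ˢ T k` control the deviation of the fiber integrals over the
union of the `T k`. -/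
theorem setIntegral_abs_fiber_sub_le {ι : Type*} [Fintype ι] {S : Set (Fin n → ℝ)}
    {T : ι → Set (Fin m → ℝ)} (hT : ∀ k, MeasurableSet (T k)) (hT' : ∀ k, volume (T k) ≠ ⊤)
    (hd : Pairwise (Function.onFun Disjoint T)) (hS : volume S ≠ ⊤)
    (hb : ∀ k, IntegrableOn b (S ×ˢ T k)) (c : ι → ℝ) :
    ∫ x in S, |(∫ y in ⋃ k, T k, b (x, y)) - ∑ k, (volume (T k)).toReal * c k| ≤
      ∑ k, ∫ z in S ×ˢ T k, |b z - c k| := by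
  have hdev (k : ι) : IntegrableOn (fun z => |b z - c k|) (S ×ˢ T k) := by
    refine integrableOn_abs_sub_const ?_ (hb k) (c k)
    rw [Measure.volume_eq_prod, Measure.prod_prod]
    exact ENNReal.mul_ne_top hS (hT' k)
  have hfib (k : ι) : ∫ z in S ×ˢ T k, |b z - c k| = ∫ x in S, ∫ y in T k, |b (x, y) - c k| := by
    have := hdev k
    rw [Measure.volume_eq_prod] at this ⊢
    exact setIntegral_prod _ this
  have hint (k : ι) : IntegrableOn (fun x => ∫ y in T k, |b (x, y) - c k|) S :=
    (integrableOn_prod_iff.1 (hdev k)).integral_prod_left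
  simp only [hfib]
  rw [← integral_finsetSum _ fun k _ => hint k]
  refine integral_mono_of_nonneg (Eventually.of_forall fun _ => abs_nonneg _)
    (integrable_finsetSum _ fun k _ => hint k) ?_
  have hslice : ∀ᵐ x ∂(volume.restrict S), ∀ k, IntegrableOn (fun y => b (x, y)) (T k) :=
    ae_all_iff.2 fun k => (integrableOn_prod_iff.1 (hb k)).prod_right_ae
  filter_upwards [hslice] with x hx
  rw [integral_iUnion_fintype hT hd hx, ← Finset.sum_sub_distrib]
  refine (Finset.abs_sum_le_sum_abs _ _).trans (Finset.sum_le_sum fun k _ => ?_)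
  have : (∫ y in T k, b (x, y)) - (volume (T k)).toReal * c k = ∫ y in T k, (b (x, y) - c k) := by
    rw [integral_sub (hx k) (integrableOn_const (hT' k))]
    simp [Measure.real]
  rw [this]
  exact abs_integral_le_integral_abs

/-- The half-open subcube of `cube c (N * s)` of side `s` with multi-index `k`. -/
def tile {d : ℕ} (c : Fin d → ℝ) (s : ℝ) {N : ℕ} (k : Fin d → Fin N) : Set (Fin d → ℝ) :=
  univ.pi fun i => Ico (c i + k i * s) (c i + k i * s + s)

theorem measurableSet_tile {d N : ℕ} (c : Fin d → ℝ) (s : ℝ) (k : Fin d → Fin N) :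
    MeasurableSet (tile c s k) :=
  MeasurableSet.univ_pi fun _ => measurableSet_Ico

theorem tile_ae_eq_cube {d N : ℕ} (c : Fin d → ℝ) (s : ℝ) (k : Fin d → Fin N) :
    tile c s k =ᵐ[volume] cube (fun i => c i + k i * s) s := by
  rw [cube_eq_Icc]
  exact Measure.univ_pi_Ico_ae_eq_Icc

theorem mem_Ico_add_mul_iff {a s t : ℝ} (hs : 0 < s) {j : ℕ} (hat : a ≤ t) :
    t ∈ Ico (a + j * s) (a + j * s + s) ↔ ⌊(t - a) / s⌋₊ = j := by
  rw [Nat.floor_eq_iff (div_nonneg (sub_nonneg.2 hat) hs.le), le_div_iff₀ hs, div_lt_iff₀ hs,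
    mem_Ico, add_mul, one_mul]
  constructor <;> rintro ⟨h₁, h₂⟩ <;> constructor <;> linarith

theorem pairwise_disjoint_tile {d N : ℕ} (c : Fin d → ℝ) {s : ℝ} (hs : 0 < s) :
    Pairwise (Function.onFun Disjoint (tile c s : (Fin d → Fin N) → Set (Fin d → ℝ))) := by
  intro k k' hkk'
  refine Set.disjoint_left.2 fun x hx hx' => hkk' (funext fun i => Fin.ext ?_)
  have hi := hx i (mem_univ i)
  have hi' := hx' i (mem_univ i)
  have hci : c i ≤ x i := (le_add_of_nonneg_right (by positivity)).trans hi.1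
  rw [mem_Ico_add_mul_iff hs hci] at hi hi'
  exact hi.symm.trans hi'

theorem iUnion_tile {d N : ℕ} (c : Fin d → ℝ) {s : ℝ} (hs : 0 < s) :
    ⋃ k : Fin d → Fin N, tile c s k = univ.pi fun i => Ico (c i) (c i + N * s) := by
  ext x
  simp only [mem_iUnion, tile, mem_univ_pi]
  constructor
  · rintro ⟨k, hk⟩ i
    have hki : ((k i : ℕ) : ℝ) + 1 ≤ N := by exact_mod_cast (k i).is_lt
    have := mul_le_mul_of_nonneg_right hki hs.le
    exact ⟨(le_add_of_nonneg_right (by positivity)).trans (hk i).1, by linarith [(hk i).2]⟩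
  · intro hx
    have hlt (i : Fin d) : ⌊(x i - c i) / s⌋₊ < N := by
      rw [Nat.floor_lt (div_nonneg (sub_nonneg.2 (hx i).1) hs.le), div_lt_iff₀ hs]
      linarith [(hx i).2]
    exact ⟨fun i => ⟨_, hlt i⟩, fun i => (mem_Ico_add_mul_iff hs (hx i).1).2 rfl⟩

theorem oscOn_flagRect_le_of_le_two_mul (hb : LocallyIntegrable b volume) {A : ℝ}
    (hA : ∀ a c r, 0 < r → oscOn (flagRect a r c r) b ≤ A) (a : Fin n → ℝ) (c : Fin m → ℝ)
    {r s : ℝ} (hr : 0 < r) (hrs : r ≤ s) (hsr : s ≤ 2 * r) :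
    oscOn (flagRect a r c s) b ≤ 2 ^ (n + 1) * A := by
  have hs : 0 < s := hr.trans_le hrs
  calc oscOn (flagRect a r c s) b ≤ 2 * 2 ^ n * oscOn (flagRect a s c s) b := by
        refine oscOn_le_of_subset (prod_mono_left (cube_subset_cube (fun _ => le_rfl)
          fun _ => by gcongr)) ?_ (isCompact_flagRect _ _ _ _).measure_ne_top
          (hb.integrableOn_isCompact (isCompact_flagRect _ _ _ _)) ?_
        · rw [volume_flagRect a c hr.le hs.le]
          positivity
        · rw [volume_flagRect a c hr.le hs.le, volume_flagRect a c hs.le hs.le, ← mul_assoc,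
            ← mul_pow]
          gcongr
    _ ≤ 2 * 2 ^ n * A := by
        gcongr
        exact hA a c s hs
    _ = _ := by ring

theorem oscOn_flagRect_le (hb : LocallyIntegrable b volume) {A K : ℝ}
    (hA : ∀ a c r, 0 < r → oscOn (flagRect a r c r) b ≤ A)
    (hK : ∀ᵐ x : Fin n → ℝ, ∀ (c : Fin m → ℝ) (s : ℝ), 0 < s →
      oscOn (cube c s) (fun y => b (x, y)) ≤ K)
    (a : Fin n → ℝ) (c : Fin m → ℝ) {r s : ℝ} (hr : 0 < r) (hrs : r ≤ s) :
    oscOn (flagRect a r c s) b ≤ 2 * (K + 2 ^ (n + 1) * A) := by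
  have hs : 0 < s := hr.trans_le hrs
  obtain ⟨N, u, hu, hru, hur, hNu⟩ : ∃ (N : ℕ) (u : ℝ), 0 < u ∧ r ≤ u ∧ u ≤ 2 * r ∧ N * u = s := by
    have hN : 1 ≤ ⌊s / r⌋₊ := Nat.one_le_floor_iff _ |>.2 ((one_le_div hr).2 hrs)
    have hN' : (1 : ℝ) ≤ ⌊s / r⌋₊ := by exact_mod_cast hN
    have hN0 : (0 : ℝ) < ⌊s / r⌋₊ := by linarith
    have hle : (⌊s / r⌋₊ : ℝ) * r ≤ s := (le_div_iff₀ hr).1 (Nat.floor_le (by positivity))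
    have hlt : s < (⌊s / r⌋₊ + 1) * r := (div_lt_iff₀ hr).1 (Nat.lt_floor_add_one _)
    refine ⟨⌊s / r⌋₊, s / ⌊s / r⌋₊, by positivity, ?_, ?_, by field_simp⟩
    · rw [le_div_iff₀ hN0]
      linarith
    · rw [div_le_iff₀ hN0]
      nlinarith
  set T : (Fin m → Fin N) → Set (Fin m → ℝ) := tile c u with hT_def
  have hI : 0 < (volume (cube a r)).toReal := by
    rw [volume_cube a hr.le]
    positivity
  have hJ : 0 < (volume (cube c s)).toReal := by
    rw [volume_cube c hs.le]
    positivity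
  have hR : (volume (flagRect a r c s)).toReal =
      (volume (cube a r)).toReal * (volume (cube c s)).toReal := by
    rw [volume_flagRect a c hr.le hs.le, volume_cube a hr.le, volume_cube c hs.le]
  have hR0 : 0 < (volume (flagRect a r c s)).toReal := hR ▸ mul_pos hI hJ
  have hU : ⋃ k, T k =ᵐ[volume] cube c s := by
    rw [hT_def, iUnion_tile c hu, hNu, cube_eq_Icc]
    exact Measure.univ_pi_Ico_ae_eq_Icc
  have hTcube (k) : T k =ᵐ[volume] cube (fun i => c i + k i * u) u := tile_ae_eq_cube c u k
  have hTtop (k) : volume (T k) ≠ ⊤ := by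
    rw [measure_congr (hTcube k)]
    exact (isCompact_cube _ _).measure_ne_top
  have hSTae (k) : (cube a r ×ˢ T k : Set (Spc n m)) =ᵐ[volume]
      flagRect a r (fun i => c i + k i * u) u :=
    Measure.set_prod_ae_eq Filter.EventuallyEq.rfl (hTcube k)
  have hbT (k) : IntegrableOn b (cube a r ×ˢ T k) :=
    (hb.integrableOn_isCompact (isCompact_flagRect _ _ _ _)).congr_set_ae (hSTae k)
  have hsum : ∑ k, (volume (T k)).toReal = (volume (cube c s)).toReal := by
    rw [← measure_congr hU, measure_iUnion (pairwise_disjoint_tile c hu)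
      fun k => measurableSet_tile c u k, tsum_fintype, ENNReal.toReal_sum fun k _ => hTtop k]
  set e : (Fin m → Fin N) → ℝ := fun k => avgOn (cube a r ×ˢ T k) b
  set E : ℝ := ∑ k, (volume (T k)).toReal * e k
  have hfib : ∫ x in cube a r, |(∫ y in cube c s, b (x, y)) - E| ≤
      2 ^ (n + 1) * A * (volume (flagRect a r c s)).toReal := by
    have hpiece (k) : ∫ z in cube a r ×ˢ T k, |b z - e k| ≤
        (volume (cube a r)).toReal * (2 ^ (n + 1) * A) * (volume (T k)).toReal := by
      have hv : (volume (cube a r ×ˢ T k : Set (Spc n m))).toReal =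
          (volume (cube a r)).toReal * (volume (T k)).toReal := by
        rw [Measure.volume_eq_prod, Measure.prod_prod, ENNReal.toReal_mul]
      have hT0 : 0 < (volume (T k)).toReal := by
        rw [measure_congr (hTcube k), volume_cube _ hu.le]
        positivity
      rw [← volume_mul_oscOn (hv ▸ mul_pos hI hT0), hv, oscOn_congr_set (hSTae k)]
      have := oscOn_flagRect_le_of_le_two_mul hb hA a (fun i => c i + k i * u) hr hru hur
      calc _ ≤ (volume (cube a r)).toReal * (volume (T k)).toReal * (2 ^ (n + 1) * A) := by gcongr
        _ = _ := by ring
    calc ∫ x in cube a r, |(∫ y in cube c s, b (x, y)) - E|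
        = ∫ x in cube a r, |(∫ y in ⋃ k, T k, b (x, y)) - E| := by
          simp only [setIntegral_congr_set hU]
      _ ≤ ∑ k, ∫ z in cube a r ×ˢ T k, |b z - e k| :=
          setIntegral_abs_fiber_sub_le (measurableSet_tile c u) hTtop (pairwise_disjoint_tile c hu)
            (isCompact_cube a r).measure_ne_top hbT e
      _ ≤ ∑ k, (volume (cube a r)).toReal * (2 ^ (n + 1) * A) * (volume (T k)).toReal :=
          Finset.sum_le_sum fun k _ => hpiece k
      _ = _ := by
          rw [← Finset.mul_sum, hsum, hR]
          ring
  set C := (volume (cube c s)).toReal⁻¹ * E with hC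
  have hCE : (volume (cube c s)).toReal * C = E := by rw [hC, mul_inv_cancel_left₀ hJ.ne']
  have hbR : IntegrableOn b (flagRect a r c s) :=
    hb.integrableOn_isCompact (isCompact_flagRect _ _ _ _)
  have hdev : IntegrableOn (fun z => |b z - C|) (flagRect a r c s) :=
    integrableOn_abs_sub_const (isCompact_flagRect _ _ _ _).measure_ne_top hbR C
  have hfibint : IntegrableOn (fun x => |(∫ y in cube c s, b (x, y)) - E|) (cube a r) :=
    integrableOn_abs_sub_const (isCompact_cube a r).measure_ne_top
      (integrableOn_prod_iff.1 hbR).integral_prod_left E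
  have hconst : IntegrableOn (fun _ : Fin n → ℝ => (volume (cube c s)).toReal * K) (cube a r) :=
    integrableOn_const (isCompact_cube a r).measure_ne_top
  have hmain : ∫ z in flagRect a r c s, |b z - C| ≤
      (volume (flagRect a r c s)).toReal * (K + 2 ^ (n + 1) * A) := by
    calc ∫ z in flagRect a r c s, |b z - C|
        = ∫ x in cube a r, ∫ y in cube c s, |b (x, y) - C| := by
          rw [Measure.volume_eq_prod] at hdev ⊢
          exact setIntegral_prod _ hdev
      _ ≤ ∫ x in cube a r,
            ((volume (cube c s)).toReal * K + |(∫ y in cube c s, b (x, y)) - E|) := by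
          refine integral_mono_ae (integrableOn_prod_iff.1 hdev).integral_prod_left
            (hconst.add hfibint) ?_
          filter_upwards [(integrableOn_prod_iff.1 hbR).prod_right_ae, ae_restrict_of_ae hK]
            with x hx hKx
          have htop : volume (cube c s) ≠ ⊤ := (isCompact_cube c s).measure_ne_top
          calc ∫ y in cube c s, |b (x, y) - C|
              ≤ ∫ y in cube c s, (|b (x, y) - avgOn (cube c s) (fun y => b (x, y))|
                  + |avgOn (cube c s) (fun y => b (x, y)) - C|) :=
                integral_mono (integrableOn_abs_sub_const htop hx _)
                  ((integrableOn_abs_sub_const htop hx _).add (integrableOn_const htop))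
                  fun y => abs_sub_le _ _ _
            _ = (volume (cube c s)).toReal * oscOn (cube c s) (fun y => b (x, y)) +
                  |(∫ y in cube c s, b (x, y)) - E| := by
                rw [integral_add (integrableOn_abs_sub_const htop hx _) (integrableOn_const htop),
                  volume_mul_oscOn hJ, ← hCE, ← volume_mul_avgOn hJ (fun y => b (x, y)), ← mul_sub,
                  abs_mul, abs_of_pos hJ]
                simp [Measure.real]
            _ ≤ _ := by
                gcongr
                exact hKx c s hs
      _ = (volume (cube a r)).toReal * ((volume (cube c s)).toReal * K) +
            ∫ x in cube a r, |(∫ y in cube c s, b (x, y)) - E| := by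
          rw [integral_add hconst hfibint]
          simp [Measure.real]
      _ ≤ (volume (cube a r)).toReal * ((volume (cube c s)).toReal * K) +
            2 ^ (n + 1) * A * (volume (flagRect a r c s)).toReal := by gcongr
      _ = _ := by
          rw [hR]
          ring
  refine le_of_mul_le_mul_left ?_ hR0
  calc _ ≤ 2 * ∫ z in flagRect a r c s, |b z - C| := volume_mul_oscOn_le hR0 hbR C
    _ ≤ 2 * ((volume (flagRect a r c s)).toReal * (K + 2 ^ (n + 1) * A)) := by gcongr
    _ = _ := by ring

end Slices

end FlagPaper

/-- `bmo_F(ℝⁿ×ℝᵐ) = BMO(ℝ^{n+m}) ∩ BMO^{(2)}(ℝᵐ)` with comparable norms. -/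
theorem statement9 (n m : ℕ) (hn : 0 < n) (hm : 0 < m) :
    ∃ c C : ℝ, 0 < c ∧ 0 < C ∧ ∀ b : Spc n m → ℝ, LocallyIntegrable b volume →
      (BddAbove (bmoFSet n m b) ↔
        (BddAbove (bmoProdSet n m b) ∧
          ∃ K : ℝ, ∀ᵐ x : Fin n → ℝ, ∀ (a : Fin m → ℝ) (ℓ : ℝ), 0 < ℓ →
            oscOn (cube a ℓ) (fun y => b (x, y)) ≤ K)) ∧
      (BddAbove (bmoFSet n m b) →
        c * max (bmoProdNorm n m b)
            (essSup (fun x : Fin n → ℝ => bmoNorm m (fun y => b (x, y))) volume)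
          ≤ bmoFNorm n m b ∧
        bmoFNorm n m b ≤
          C * max (bmoProdNorm n m b)
            (essSup (fun x : Fin n → ℝ => bmoNorm m (fun y => b (x, y))) volume)) := by
  refine ⟨(2 ^ (m + 2))⁻¹, 2 * (1 + 2 ^ (n + 1)), by positivity, by positivity, fun b hb => ?_⟩
  have hsub : bmoProdSet n m b ⊆ bmoFSet n m b := by
    rintro _ ⟨a, c, r, hr, rfl⟩
    exact ⟨a, r, c, r, hr, le_rfl, rfl⟩
  have hslice (h : BddAbove (bmoFSet n m b)) := ae_forall_oscOn_slice_le hb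
    (M := bmoFNorm n m b) fun a r c s hr hrs => le_csSup h ⟨a, r, c, s, hr, hrs, rfl⟩
  have hne : (bmoFSet n m b).Nonempty := ⟨_, 0, 1, 0, 1, one_pos, le_rfl, rfl⟩
  have hslice_ne (x : Fin n → ℝ) : (bmoSet m fun y => b (x, y)).Nonempty :=
    ⟨_, 0, 1, one_pos, rfl⟩
  have hnorm_nonneg (x : Fin n → ℝ) : 0 ≤ bmoNorm m fun y => b (x, y) := by
    refine Real.sSup_nonneg ?_
    rintro _ ⟨a, r, -, rfl⟩
    exact oscOn_nonneg _ _
  refine ⟨⟨fun h => ⟨h.mono hsub, _, hslice h⟩, ?_⟩, fun h => ?_⟩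
  · rintro ⟨⟨A, hA⟩, K, hK⟩
    refine ⟨2 * (K + 2 ^ (n + 1) * A), ?_⟩
    rintro _ ⟨a, r, c, s, hr, hrs, rfl⟩
    exact oscOn_flagRect_le hb (fun a c r hr => hA ⟨a, c, r, hr, rfl⟩) hK a c hr hrs
  have hnorm_le : ∀ᵐ x : Fin n → ℝ,
      bmoNorm m (fun y => b (x, y)) ≤ 2 ^ (m + 2) * bmoFNorm n m b := by
    filter_upwards [hslice h] with x hx
    refine csSup_le (hslice_ne x) ?_
    rintro _ ⟨a, r, hr, rfl⟩
    exact hx a r hr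
  have hF : 0 ≤ bmoFNorm n m b := by
    refine Real.sSup_nonneg ?_
    rintro _ ⟨a, r, c, s, -, -, rfl⟩
    exact oscOn_nonneg _ _
  constructor
  · rw [inv_mul_le_iff₀ (by positivity)]
    refine max_le ?_ ?_
    · calc bmoProdNorm n m b ≤ bmoFNorm n m b :=
            csSup_le_csSup h ⟨_, 0, 0, 1, one_pos, rfl⟩ hsub
        _ ≤ 2 ^ (m + 2) * bmoFNorm n m b :=
            le_mul_of_one_le_left hF (one_le_pow₀ one_le_two)
    · exact essSup_le_of_ae_le _ hnorm_le
        (isBoundedUnder_of ⟨0, hnorm_nonneg⟩ : IsBoundedUnder (· ≥ ·) _ _).isCoboundedUnder_le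
  · refine csSup_le hne ?_
    rintro _ ⟨a, r, c, s, hr, hrs, rfl⟩
    have hK : ∀ᵐ x : Fin n → ℝ, ∀ (c : Fin m → ℝ) (s : ℝ), 0 < s →
        oscOn (cube c s) (fun y => b (x, y)) ≤
          essSup (fun x : Fin n → ℝ => bmoNorm m (fun y => b (x, y))) volume := by
      filter_upwards [hslice h, ae_le_essSup (isBoundedUnder_of_eventually_le hnorm_le)]
        with x hx hxe c s hs
      have hbdd : BddAbove (bmoSet m fun y => b (x, y)) := by
        refine ⟨2 ^ (m + 2) * bmoFNorm n m b, ?_⟩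
        rintro _ ⟨a, r, hr, rfl⟩
        exact hx a r hr
      exact le_trans (le_csSup hbdd ⟨c, s, hs, rfl⟩) hxe
    refine (oscOn_flagRect_le hb
      (fun a c r hr => le_csSup (h.mono hsub) ⟨a, c, r, hr, rfl⟩) hK a c hr hrs).trans ?_
    rw [mul_assoc, add_mul, one_mul]
    gcongr
    · exact le_max_right _ _
    · exact le_max_left _ _
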